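/- Let 0 < p < 1, let f ∈ L^2(T), and let F be a C^1 function on the unit disk D such that lim_{r→1⁻} F(re^{it}) = f(e^{it}) for a.e. e^{it} ∈ T. If the measure |∇F(z)|^2 (1 - |z|^2)^p dA(z) is a p-Carleson measure on D, then f ∈ Q_p(T). -/

import Mathlib

open MeasureTheory Complex Metric Set Filter
open scoped ENNReal Real

noncomputable section

/-- The open unit disk in `ℂ`. -/
def unitDisk : Set ℂ := Metric.ball 0 1

/-- The Möbius automorphism `φ_a(z) = (a - z)/(1 - ā z)` of the unit disk. -/
def moebius (a z : ℂ) : ℂ := (a - z) / (1 - (starRingEnd ℂ) a * z)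

/-- Membership in `H^∞(𝔻)`: bounded analytic functions on the unit disk. -/
def MemHinf (f : ℂ → ℂ) : Prop :=
  DifferentiableOn ℂ f unitDisk ∧ ∃ M : ℝ, ∀ z ∈ unitDisk, ‖f z‖ ≤ M

/-- The integral `∫_𝔻 |f'(z)|² (1 - |φ_a(z)|²)^p dA(z)`. -/
def qpIntegral (p : ℝ) (f : ℂ → ℂ) (a : ℂ) : ℝ≥0∞ :=
  ∫⁻ z in unitDisk, ENNReal.ofReal (‖deriv f z‖ ^ 2 * (1 - ‖moebius a z‖ ^ 2) ^ p)

/-- Finiteness of the `H²`-part of the `Q_p` norm: the integrals of `|f|²` over circles of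
radius `r < 1` are uniformly bounded (equivalently, the boundary integral `∫ |f|² dσ`
is finite). -/
def h2Bounded (f : ℂ → ℂ) : Prop :=
  ∃ M : ℝ, ∀ r ∈ Set.Ico (0 : ℝ) 1,
    (∫ t in (0 : ℝ)..(2 * Real.pi), ‖f ((r : ℂ) * Complex.exp (Complex.I * t))‖ ^ 2) ≤ M

/-- Membership in the space `Q_p`: `f` is analytic on the unit disk and
`‖f‖_{Q_p}² = ∫_𝕋 |f|² dσ + sup_{a ∈ 𝔻} ∫_𝔻 |f'(z)|² (1 - |φ_a(z)|²)^p dA(z) < ∞`. -/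
def MemQp (p : ℝ) (f : ℂ → ℂ) : Prop :=
  DifferentiableOn ℂ f unitDisk ∧ h2Bounded f ∧
    ∃ C : ℝ, ∀ a ∈ unitDisk, qpIntegral p f a ≤ ENNReal.ofReal C

/-- The multiplier algebra `M(Q_p)`. -/
def MemMQp (p : ℝ) (φ : ℂ → ℂ) : Prop :=
  MemQp p φ ∧ ∀ f : ℂ → ℂ, MemQp p f → MemQp p (fun z => φ z * f z)

/-- The Carleson square `S(I)` over the arc of the unit circle centered at `e^{iθ}` with
normalized length `h`. -/
def carlesonBox (θ h : ℝ) : Set ℂ :=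
  {z : ℂ | 1 - h < ‖z‖ ∧ ‖z‖ < 1 ∧
    ∃ t : ℝ, |t - θ| < Real.pi * h ∧ z = (‖z‖ : ℂ) * Complex.exp (Complex.I * t)}

/-- A measure `μ` on the unit disk is a `p`-Carleson measure if `μ(S(I)) ≤ C |I|^p`
for every arc `I` of the unit circle. -/
def IsPCarleson (p : ℝ) (μ : Measure ℂ) : Prop :=
  ∃ C : ℝ, ∀ θ : ℝ, ∀ h ∈ Set.Ioc (0 : ℝ) 1,
    μ (carlesonBox θ h) ≤ ENNReal.ofReal (C * h ^ p)

/-- The `p`-Carleson constant `‖μ‖_p = sup_{I ⊂ 𝕋} μ(S(I))/|I|^p`. -/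
def pCarlesonNorm (p : ℝ) (μ : Measure ℂ) : ℝ≥0∞ :=
  ⨆ (θ : ℝ) (h : ℝ) (_ : h ∈ Set.Ioc (0 : ℝ) 1),
    μ (carlesonBox θ h) / ENNReal.ofReal (h ^ p)

/-- The measure `w(z) dA(z)` on the unit disk. -/
def diskMeasure (w : ℂ → ℝ) : Measure ℂ :=
  (volume.restrict unitDisk).withDensity fun z => ENNReal.ofReal (w z)

/-- The Wirtinger derivative `∂F/∂z`. -/
def wderiv (F : ℂ → ℂ) (z : ℂ) : ℂ :=
  (fderiv ℝ F z 1 - Complex.I * fderiv ℝ F z Complex.I) / 2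

/-- The Wirtinger derivative `∂F/∂z̄`. -/
def wderivBar (F : ℂ → ℂ) (z : ℂ) : ℂ :=
  (fderiv ℝ F z 1 + Complex.I * fderiv ℝ F z Complex.I) / 2

/-- The squared length of the (real) gradient: `|∇F|² = 2|∂F/∂z|² + 2|∂F/∂z̄|²`. -/
def gradSq (F : ℂ → ℂ) (z : ℂ) : ℝ :=
  2 * ‖wderiv F z‖ ^ 2 + 2 * ‖wderivBar F z‖ ^ 2

/-- The arc of the unit circle centered at `e^{iθ}` of normalized length `h`, parametrized
by angle. -/
def arcInterval (θ h : ℝ) : Set ℝ := Set.Ioo (θ - Real.pi * h) (θ + Real.pi * h)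

/-- The double integral `∫_I ∫_I |f(ξ) - f(η)|²/|ξ - η|^{2-p} |dξ| |dη|` over the arc
centered at `e^{iθ}` of normalized length `h`. -/
def qpTDouble (p : ℝ) (f : ℝ → ℂ) (θ h : ℝ) : ℝ≥0∞ :=
  ∫⁻ s in arcInterval θ h, ∫⁻ u in arcInterval θ h,
    ENNReal.ofReal (‖f s - f u‖ ^ 2 /
      ‖Complex.exp (Complex.I * s) - Complex.exp (Complex.I * u)‖ ^ (2 - p))

/-- The integral `∫_𝕋 |f|² dσ` of a function on the unit circle (parametrized by angle). -/
def l2Circle (f : ℝ → ℂ) : ℝ≥0∞ :=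
  ∫⁻ t in Set.Ioc (0 : ℝ) (2 * Real.pi), (‖f t‖₊ : ℝ≥0∞) ^ 2

/-- Membership in `Q_p(𝕋)` for a function on the unit circle (parametrized by angle):
`f ∈ L²(𝕋)` and `sup_{I ⊂ 𝕋} |I|^{-p} ∫_I ∫_I |f(ξ) - f(η)|²/|ξ - η|^{2-p} |dξ||dη| < ∞`. -/
def MemQpT (p : ℝ) (f : ℝ → ℂ) : Prop :=
  Function.Periodic f (2 * Real.pi) ∧ Measurable f ∧ l2Circle f < ⊤ ∧
    ∃ C : ℝ, ∀ θ : ℝ, ∀ h ∈ Set.Ioc (0 : ℝ) 1, qpTDouble p f θ h ≤ ENNReal.ofReal (C * h ^ p)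

/-- The square of the `Q_p` norm of an analytic function `f` on the disk with boundary
values `fb`. -/
def qpNormSq (p : ℝ) (f : ℂ → ℂ) (fb : ℝ → ℂ) : ℝ≥0∞ :=
  l2Circle fb + ⨆ a ∈ unitDisk, qpIntegral p f a

/-- The square of the `Q_p(𝕋)` norm of a function on the unit circle. -/
def qpTNormSq (p : ℝ) (fb : ℝ → ℂ) : ℝ≥0∞ :=
  l2Circle fb + ⨆ (θ : ℝ) (h : ℝ) (_ : h ∈ Set.Ioc (0 : ℝ) 1),
    qpTDouble p fb θ h / ENNReal.ofReal (h ^ p)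

/-- `fb` is the a.e. radial boundary-value function of `F`. -/
def RadialLimit (F : ℂ → ℂ) (fb : ℝ → ℂ) : Prop :=
  ∀ᵐ t : ℝ, Filter.Tendsto (fun r : ℝ => F ((r : ℂ) * Complex.exp (Complex.I * t)))
    (nhdsWithin 1 (Set.Iio 1)) (nhds (fb t))

/-- The Poisson integral (harmonic extension) of a function on the unit circle. -/
def poissonExt (f : ℝ → ℂ) (z : ℂ) : ℂ :=
  (1 / (2 * Real.pi)) • ∫ t in (0 : ℝ)..(2 * Real.pi),
    ((1 - ‖z‖ ^ 2) / ‖Complex.exp (Complex.I * t) - z‖ ^ 2) • f t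


lemma qaux_cs {α : Type*} [MeasurableSpace α] (μ : Measure α) {u v : α → ℝ≥0∞}
    (hu : AEMeasurable u μ) (hv : AEMeasurable v μ) :
    (∫⁻ x, u x * v x ∂μ) ^ 2 ≤ (∫⁻ x, u x ^ 2 ∂μ) * ∫⁻ x, v x ^ 2 ∂μ := by
  have h := ENNReal.lintegral_mul_le_Lp_mul_Lq μ Real.HolderConjugate.two_two hu hv
  simp only [Pi.mul_apply] at h
  calc (∫⁻ x, u x * v x ∂μ) ^ 2 ≤ _ := pow_le_pow_left' h 2
    _ = _ := by
      rw [mul_pow, ← ENNReal.rpow_natCast, ← ENNReal.rpow_natCast, ← ENNReal.rpow_mul,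
        ← ENNReal.rpow_mul]
      norm_num

lemma qaux_sq3 (a b c : ℝ≥0∞) : (a + b + c) ^ 2 ≤ 9 * (a ^ 2 + b ^ 2 + c ^ 2) := by
  have key : ∀ m : ℝ≥0∞, a ≤ m → b ≤ m → c ≤ m → m ^ 2 ≤ a ^ 2 + b ^ 2 + c ^ 2 →
      (a + b + c) ^ 2 ≤ 9 * (a ^ 2 + b ^ 2 + c ^ 2) := by
    intro m ha hb hc hm
    calc (a + b + c) ^ 2 ≤ (m + m + m) ^ 2 := by gcongr
      _ = 9 * m ^ 2 := by ring
      _ ≤ _ := by gcongr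
  rcases le_total a b with h1 | h1 <;> rcases le_total b c with h2 | h2 <;>
    rcases le_total a c with h3 | h3
  · exact key c h3 h2 le_rfl le_add_self
  · exact key c (h1.trans h2) h2 le_rfl le_add_self
  · exact key b h1 le_rfl h2 (le_add_self.trans le_self_add)
  · exact key b h1 le_rfl h2 (le_add_self.trans le_self_add)
  · exact key c h3 h2 le_rfl le_add_self
  · exact key a le_rfl h1 h3 (le_self_add.trans le_self_add)
  · exact key a le_rfl h1 (h2.trans h1) (le_self_add.trans le_self_add)
  · exact key a le_rfl h1 h3 (le_self_add.trans le_self_add)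

lemma qaux_shift {Φ : ℝ → ℝ≥0∞} {a b c d : ℝ} (hc : 0 ≤ c) (hcd : c ≤ d) :
    ∫⁻ s in Ioo a b, Φ (s + c) ≤ ∫⁻ s in Ioo a (b + d), Φ s := by
  rw [← lintegral_indicator measurableSet_Ioo, ← lintegral_indicator measurableSet_Ioo,
    ← lintegral_add_right_eq_self ((Ioo a (b + d)).indicator Φ) c]
  apply lintegral_mono
  intro s
  by_cases hs : s ∈ Ioo a b
  · have : s + c ∈ Ioo a (b + d) := ⟨by linarith [hs.1], by linarith [hs.2]⟩
    simp [indicator_of_mem hs, indicator_of_mem this]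
  · simp [indicator_of_notMem hs]

lemma qaux_powint {b y : ℝ} (hb1 : b < 1) (hy : 0 < y) :
    ∫⁻ x in Ioo 0 y, ENNReal.ofReal (x ^ (-b)) = ENNReal.ofReal (y ^ (1 - b) / (1 - b)) := by
  have hi : IntervalIntegrable (fun x : ℝ => x ^ (-b)) volume 0 y :=
    intervalIntegral.intervalIntegrable_rpow' (by linarith)
  rw [restrict_Ioo_eq_restrict_Ioc, ← ofReal_integral_eq_lintegral_ofReal
    ((intervalIntegrable_iff_integrableOn_Ioc_of_le hy.le).1 hi),
    ← intervalIntegral.integral_of_le hy.le, integral_rpow (Or.inl (by linarith))]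
  · rw [Real.zero_rpow (by linarith)]
    congr 1
    rw [sub_zero, show -b + 1 = 1 - b by ring]
  · filter_upwards [self_mem_ae_restrict measurableSet_Ioc] with x hx
    exact Real.rpow_nonneg hx.1.le _

lemma qaux_powint2 {q x : ℝ} (hq : q < -1) (hx : 0 < x) :
    ∫⁻ y in Ioi x, ENNReal.ofReal (y ^ q) = ENNReal.ofReal (x ^ (q + 1) / (-(q + 1))) := by
  rw [← ofReal_integral_eq_lintegral_ofReal (integrableOn_Ioi_rpow_of_lt hq hx),
    integral_Ioi_rpow_of_lt hq hx]
  · congr 1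
    rw [div_neg, neg_div]
  · filter_upwards [self_mem_ae_restrict measurableSet_Ioi] with y hy
    exact Real.rpow_nonneg (hx.trans hy).le _

def qK (p : ℝ) : ℝ≥0∞ := ENNReal.ofReal (4 / (1 - p) ^ 2)

lemma qaux_hardy {p : ℝ} (hp1 : p < 1) {g : ℝ → ℝ≥0∞} (hg : Measurable g) (l : ℝ) :
    ∫⁻ y in Ioo 0 l, ENNReal.ofReal (y ^ (p - 2)) * (∫⁻ x in Ioo 0 y, g x) ^ 2 ≤
      qK p * ∫⁻ x in Ioo 0 l, ENNReal.ofReal (x ^ p) * g x ^ 2 := by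
  set b : ℝ := (1 + p) / 2 with hb
  have hb1 : b < 1 := by rw [hb]; linarith
  have hbp : p < b := by rw [hb]; linarith
  have step1 : ∀ y ∈ Ioo 0 l, ENNReal.ofReal (y ^ (p - 2)) * (∫⁻ x in Ioo 0 y, g x) ^ 2 ≤
      ENNReal.ofReal (2 / (1 - p)) * ∫⁻ x in Ioo 0 l, (Ioi x).indicator
        (fun y => ENNReal.ofReal (y ^ (p - 1 - b))) y * (ENNReal.ofReal (x ^ b) * g x ^ 2) := by
    intro y hy
    have hy0 : 0 < y := hy.1
    have h1 : ∫⁻ x in Ioo 0 y, g x = ∫⁻ x in Ioo 0 y,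
        ENNReal.ofReal (x ^ (-b / 2)) * (ENNReal.ofReal (x ^ (b / 2)) * g x) := by
      refine setLIntegral_congr_fun measurableSet_Ioo fun x hx => ?_
      rw [← mul_assoc, ← ENNReal.ofReal_mul (Real.rpow_nonneg hx.1.le _), ← Real.rpow_add hx.1]
      simp [show -b / 2 + b / 2 = 0 by ring]
    have h2 : (∫⁻ x in Ioo 0 y, g x) ^ 2 ≤ ENNReal.ofReal (y ^ (1 - b) / (1 - b)) *
        ∫⁻ x in Ioo 0 y, ENNReal.ofReal (x ^ b) * g x ^ 2 := by
      rw [h1]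
      refine (qaux_cs _ (by fun_prop) (by fun_prop)).trans_eq ?_
      rw [← qaux_powint hb1 hy0]
      congr 1
      · refine setLIntegral_congr_fun measurableSet_Ioo fun x hx => ?_
        rw [← ENNReal.ofReal_pow (Real.rpow_nonneg hx.1.le _), ← Real.rpow_natCast,
          ← Real.rpow_mul hx.1.le]
        norm_num
      · refine setLIntegral_congr_fun measurableSet_Ioo fun x hx => ?_
        rw [mul_pow, ← ENNReal.ofReal_pow (Real.rpow_nonneg hx.1.le _), ← Real.rpow_natCast,
          ← Real.rpow_mul hx.1.le]
        norm_num
    calc _ ≤ ENNReal.ofReal (y ^ (p - 2)) * (ENNReal.ofReal (y ^ (1 - b) / (1 - b)) *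
        ∫⁻ x in Ioo 0 y, ENNReal.ofReal (x ^ b) * g x ^ 2) := by gcongr
      _ = ENNReal.ofReal (2 / (1 - p)) * (ENNReal.ofReal (y ^ (p - 1 - b)) *
        ∫⁻ x in Ioo 0 y, ENNReal.ofReal (x ^ b) * g x ^ 2) := by
          rw [← mul_assoc, ← mul_assoc, ← ENNReal.ofReal_mul (by positivity),
            ← ENNReal.ofReal_mul (by apply div_nonneg <;> linarith)]
          congr 2
          rw [show p - 1 - b = (p - 2) + (1 - b) by ring, Real.rpow_add hy0, hb]
          have : (1 - p) ≠ 0 := by linarith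
          rw [show 1 - (1 + p) / 2 = (1 - p) / 2 by ring]
          field_simp
      _ ≤ _ := by
          gcongr
          rw [← lintegral_const_mul _ (by fun_prop), ← lintegral_indicator measurableSet_Ioo,
            ← lintegral_indicator measurableSet_Ioo]
          apply lintegral_mono
          intro x
          by_cases hx : x ∈ Ioo 0 y
          · have hx' : x ∈ Ioo 0 l := ⟨hx.1, hx.2.trans hy.2⟩
            have hx2 : y ∈ Ioi x := hx.2
            simp [indicator_of_mem hx, indicator_of_mem hx', hx.2]
          · simp [indicator_of_notMem hx]
  have meas : Measurable (Function.uncurry fun y x : ℝ => (Ioi x).indicator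
        (fun y => ENNReal.ofReal (y ^ (p - 1 - b))) y * (ENNReal.ofReal (x ^ b) * g x ^ 2)) := by
    have : (fun q : ℝ × ℝ => (Ioi q.2).indicator
        (fun y => ENNReal.ofReal (y ^ (p - 1 - b))) q.1) =
        {q : ℝ × ℝ | q.2 < q.1}.indicator (fun q => ENNReal.ofReal (q.1 ^ (p - 1 - b))) := by
      ext q; simp [indicator]
    apply Measurable.mul (f := fun q : ℝ × ℝ => (Ioi q.2).indicator
        (fun y => ENNReal.ofReal (y ^ (p - 1 - b))) q.1)
    · rw [this]
      exact Measurable.indicator (by fun_prop) (measurableSet_lt measurable_snd measurable_fst)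
    · fun_prop
  calc _ ≤ ∫⁻ y in Ioo 0 l, ENNReal.ofReal (2 / (1 - p)) * ∫⁻ x in Ioo 0 l, (Ioi x).indicator
        (fun y => ENNReal.ofReal (y ^ (p - 1 - b))) y * (ENNReal.ofReal (x ^ b) * g x ^ 2) :=
        setLIntegral_mono' measurableSet_Ioo step1
    _ = ENNReal.ofReal (2 / (1 - p)) * ∫⁻ y in Ioo 0 l, ∫⁻ x in Ioo 0 l, (Ioi x).indicator
        (fun y => ENNReal.ofReal (y ^ (p - 1 - b))) y * (ENNReal.ofReal (x ^ b) * g x ^ 2) := by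
        rw [lintegral_const_mul']
        exact ENNReal.ofReal_ne_top
    _ = ENNReal.ofReal (2 / (1 - p)) * ∫⁻ x in Ioo 0 l, ∫⁻ y in Ioo 0 l, (Ioi x).indicator
        (fun y => ENNReal.ofReal (y ^ (p - 1 - b))) y * (ENNReal.ofReal (x ^ b) * g x ^ 2) := by
        rw [lintegral_lintegral_swap meas.aemeasurable]
    _ ≤ ENNReal.ofReal (2 / (1 - p)) * ∫⁻ x in Ioo 0 l, ENNReal.ofReal (2 / (1 - p)) *
          (ENNReal.ofReal (x ^ p) * g x ^ 2) := by
        gcongr ENNReal.ofReal (2 / (1 - p)) * ?_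
        refine setLIntegral_mono' measurableSet_Ioo fun x hx => ?_
        rw [lintegral_mul_const _ (by
          exact Measurable.indicator (by fun_prop) measurableSet_Ioi)]
        calc _ ≤ (∫⁻ y, (Ioi x).indicator (fun y => ENNReal.ofReal (y ^ (p - 1 - b))) y) *
              (ENNReal.ofReal (x ^ b) * g x ^ 2) := by
              gcongr
              exact Measure.restrict_le_self
          _ = _ := by
              rw [lintegral_indicator measurableSet_Ioi, qaux_powint2 (by linarith) hx.1,
                ← mul_assoc, ← mul_assoc, ← ENNReal.ofReal_mul', ← ENNReal.ofReal_mul']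
              · congr 2
                have e : x ^ p = x ^ (p - 1 - b + 1) * x ^ b := by
                  rw [← Real.rpow_add hx.1]; congr 1; ring
                rw [e, hb]
                have : (1 - p) ≠ 0 := by linarith
                rw [show -(p - 1 - (1 + p) / 2 + 1) = (1 - p) / 2 by ring]
                field_simp
              · exact Real.rpow_nonneg hx.1.le _
              · exact Real.rpow_nonneg hx.1.le _
    _ = _ := by
        rw [lintegral_const_mul' _ _ ENNReal.ofReal_ne_top, ← mul_assoc,
          ← ENNReal.ofReal_mul (by apply div_nonneg <;> linarith), qK]
        congr 2
        have : (1 - p) ≠ 0 := by linarith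
        field_simp
        norm_num

lemma qaux_measA {g : ℝ → ℝ → ℝ≥0∞} (hg : Measurable (Function.uncurry g)) :
    Measurable (fun q : ℝ × ℝ => ∫⁻ x in Ioo 0 q.2, g x q.1) := by
  have : (fun q : ℝ × ℝ => ∫⁻ x in Ioo 0 q.2, g x q.1) =
      fun q : ℝ × ℝ => ∫⁻ x, {w : (ℝ × ℝ) × ℝ | 0 < w.2 ∧ w.2 < w.1.2}.indicator
        (fun w => g w.2 w.1.1) (q, x) := by
    ext q
    rw [← lintegral_indicator measurableSet_Ioo]
    apply lintegral_congr
    intro x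
    simp [indicator]
  rw [this]
  apply Measurable.lintegral_prod_right'
  apply Measurable.indicator
  · exact hg.comp (by fun_prop : Measurable fun w : (ℝ × ℝ) × ℝ => (w.2, w.1.1))
  · have e1 : MeasurableSet {w : (ℝ × ℝ) × ℝ | 0 < w.2} :=
      measurableSet_lt (by fun_prop) (by fun_prop)
    have e2 : MeasurableSet {w : (ℝ × ℝ) × ℝ | w.2 < w.1.2} :=
      measurableSet_lt (by fun_prop) (by fun_prop)
    exact e1.inter e2

lemma qaux_measB {g : ℝ → ℝ → ℝ≥0∞} (hg : Measurable (Function.uncurry g)) :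
    Measurable (fun q : ℝ × ℝ => ∫⁻ x in Ioo 0 (2 * π * q.2), g q.2 (q.1 + x)) := by
  have : (fun q : ℝ × ℝ => ∫⁻ x in Ioo 0 (2 * π * q.2), g q.2 (q.1 + x)) =
      fun q : ℝ × ℝ => ∫⁻ x, {w : (ℝ × ℝ) × ℝ | 0 < w.2 ∧ w.2 < 2 * π * w.1.2}.indicator
        (fun w => g w.1.2 (w.1.1 + w.2)) (q, x) := by
    ext q
    rw [← lintegral_indicator measurableSet_Ioo]
    apply lintegral_congr
    intro x
    simp [indicator]
  rw [this]
  apply Measurable.lintegral_prod_right'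
  apply Measurable.indicator
  · exact hg.comp (by fun_prop : Measurable fun w : (ℝ × ℝ) × ℝ => (w.1.2, w.1.1 + w.2))
  · have e1 : MeasurableSet {w : (ℝ × ℝ) × ℝ | 0 < w.2} :=
      measurableSet_lt (by fun_prop) (by fun_prop)
    have e2 : MeasurableSet {w : (ℝ × ℝ) × ℝ | w.2 < 2 * π * w.1.2} :=
      measurableSet_lt (by fun_prop) (by fun_prop)
    exact e1.inter e2

lemma qaux_core {p : ℝ} (hp1 : p < 1) {g : ℝ → ℝ → ℝ≥0∞} (hg : Measurable (Function.uncurry g))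
    (a b l : ℝ) (hl : 0 < l) :
    ∫⁻ s in Ioo a b, ∫⁻ y in Ioo 0 l, ENNReal.ofReal (y ^ (p - 2)) *
      ((∫⁻ x in Ioo 0 y, g x s) + (∫⁻ x in Ioo 0 (2 * π * y), g y (s + x)) +
        ∫⁻ x in Ioo 0 y, g x (s + 2 * π * y)) ^ 2 ≤
    9 * (2 * qK p + ENNReal.ofReal ((2 * π) ^ 2)) *
      ∫⁻ v in Ioo a (b + 2 * π * l), ∫⁻ y in Ioo 0 l, ENNReal.ofReal (y ^ p) * g y v ^ 2 := by
  set V := ∫⁻ v in Ioo a (b + 2 * π * l), ∫⁻ y in Ioo 0 l, ENNReal.ofReal (y ^ p) * g y v ^ 2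
    with hV
  have mA := qaux_measA hg
  have mB := qaux_measB hg
  have hgs : ∀ s, Measurable (fun x => g x s) := fun s =>
    hg.comp (by fun_prop : Measurable fun x : ℝ => (x, s))
  have hgy : ∀ y, Measurable (fun x => g y x) := fun y =>
    hg.comp (by fun_prop : Measurable fun x : ℝ => (y, x))
  have mw : Measurable (fun q : ℝ × ℝ => ENNReal.ofReal (q.2 ^ (p - 2))) := by fun_prop
  -- first term, on an arbitrary interval contained in the big one
  have T1' : ∫⁻ s in Ioo a (b + 2 * π * l), ∫⁻ y in Ioo 0 l, ENNReal.ofReal (y ^ (p - 2)) *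
      (∫⁻ x in Ioo 0 y, g x s) ^ 2 ≤ qK p * V := by
    rw [hV, ← lintegral_const_mul' _ _ (by exact ENNReal.ofReal_ne_top)]
    exact lintegral_mono fun s => qaux_hardy hp1 (hgs s) l
  have hpl : 0 < 2 * π * l := by positivity
  have T1 : ∫⁻ s in Ioo a b, ∫⁻ y in Ioo 0 l, ENNReal.ofReal (y ^ (p - 2)) *
      (∫⁻ x in Ioo 0 y, g x s) ^ 2 ≤ qK p * V :=
    (lintegral_mono_set (Ioo_subset_Ioo le_rfl (by linarith))).trans T1'
  have T3 : ∫⁻ s in Ioo a b, ∫⁻ y in Ioo 0 l, ENNReal.ofReal (y ^ (p - 2)) *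
      (∫⁻ x in Ioo 0 y, g x (s + 2 * π * y)) ^ 2 ≤ qK p * V := by
    rw [lintegral_lintegral_swap (by
      refine Measurable.aemeasurable ?_
      refine mw.mul ((mA.comp
        (by fun_prop : Measurable fun q : ℝ × ℝ => (q.1 + 2 * π * q.2, q.2))).pow_const 2))]
    have T1s := T1'
    rw [lintegral_lintegral_swap (by
      refine Measurable.aemeasurable ?_
      refine mw.mul (mA.pow_const 2))] at T1s
    refine le_trans ?_ T1s
    refine setLIntegral_mono' measurableSet_Ioo fun y hy => ?_
    have h0 := hy.1
    have h1 := hy.2.le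
    exact qaux_shift (Φ := fun s => ENNReal.ofReal (y ^ (p - 2)) *
      (∫⁻ x in Ioo 0 y, g x s) ^ 2) (by positivity) (by gcongr)
  have T2 : ∫⁻ s in Ioo a b, ∫⁻ y in Ioo 0 l, ENNReal.ofReal (y ^ (p - 2)) *
      (∫⁻ x in Ioo 0 (2 * π * y), g y (s + x)) ^ 2 ≤ ENNReal.ofReal ((2 * π) ^ 2) * V := by
    have hVs := hV
    rw [lintegral_lintegral_swap (by
      refine Measurable.aemeasurable ?_
      refine Measurable.mul (f := fun q : ℝ × ℝ => ENNReal.ofReal (q.2 ^ p)) (by fun_prop)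
        ((hg.comp (by fun_prop : Measurable fun q : ℝ × ℝ => (q.2, q.1))).pow_const 2))] at hVs
    rw [lintegral_lintegral_swap (by
      refine Measurable.aemeasurable ?_
      refine mw.mul (mB.pow_const 2)), hVs,
      ← lintegral_const_mul' _ _ (by exact ENNReal.ofReal_ne_top)]
    refine setLIntegral_mono' measurableSet_Ioo fun y hy => ?_
    have h0 := hy.1
    have h1 := hy.2.le
    have cs : ∀ s, (∫⁻ x in Ioo 0 (2 * π * y), g y (s + x)) ^ 2 ≤
        ENNReal.ofReal (2 * π * y) * ∫⁻ x in Ioo 0 (2 * π * y), g y (s + x) ^ 2 := by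
      intro s
      have := qaux_cs (volume.restrict (Ioo 0 (2 * π * y))) (u := fun _ => 1)
        (v := fun x => g y (s + x)) (by fun_prop)
        ((hgy y).comp (by fun_prop : Measurable fun x : ℝ => s + x)).aemeasurable
      simpa using this
    calc _ ≤ ∫⁻ s in Ioo a b, ENNReal.ofReal (y ^ (p - 2)) * (ENNReal.ofReal (2 * π * y) *
            ∫⁻ x in Ioo 0 (2 * π * y), g y (s + x) ^ 2) := by
          gcongr with s
          exact cs s
      _ = ENNReal.ofReal (y ^ (p - 2)) * (ENNReal.ofReal (2 * π * y) *
            ∫⁻ s in Ioo a b, ∫⁻ x in Ioo 0 (2 * π * y), g y (s + x) ^ 2) := by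
          rw [lintegral_const_mul' _ _ ENNReal.ofReal_ne_top,
            lintegral_const_mul' _ _ ENNReal.ofReal_ne_top]
      _ = ENNReal.ofReal (y ^ (p - 2)) * (ENNReal.ofReal (2 * π * y) *
            ∫⁻ x in Ioo 0 (2 * π * y), ∫⁻ s in Ioo a b, g y (s + x) ^ 2) := by
          rw [lintegral_lintegral_swap (by
            refine Measurable.aemeasurable ?_
            exact ((hgy y).comp
              (by fun_prop : Measurable fun q : ℝ × ℝ => q.1 + q.2)).pow_const 2)]
      _ ≤ ENNReal.ofReal (y ^ (p - 2)) * (ENNReal.ofReal (2 * π * y) *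
            ∫⁻ x in Ioo 0 (2 * π * y), ∫⁻ s in Ioo a (b + 2 * π * l), g y s ^ 2) := by
          gcongr ENNReal.ofReal (y ^ (p - 2)) * (ENNReal.ofReal (2 * π * y) * ?_)
          refine setLIntegral_mono' measurableSet_Ioo fun x hx => ?_
          refine qaux_shift (Φ := fun s => g y s ^ 2) hx.1.le (hx.2.le.trans ?_)
          gcongr
      _ = _ := by
          rw [setLIntegral_const, Real.volume_Ioo, sub_zero,
            lintegral_const_mul' _ _ ENNReal.ofReal_ne_top,
            mul_comm _ (ENNReal.ofReal (2 * π * y)), ← mul_assoc, ← mul_assoc, ← mul_assoc,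
            ← ENNReal.ofReal_mul (by positivity), ← ENNReal.ofReal_mul (by positivity),
            ← ENNReal.ofReal_mul (by positivity)]
          congr 2
          have : y ^ p = y ^ (p - 2) * y ^ 2 := by
            rw [← Real.rpow_natCast, ← Real.rpow_add h0]
            norm_num
          rw [this]; ring
  calc _ ≤ ∫⁻ s in Ioo a b, ∫⁻ y in Ioo 0 l, 9 * (ENNReal.ofReal (y ^ (p - 2)) *
      (∫⁻ x in Ioo 0 y, g x s) ^ 2 + ENNReal.ofReal (y ^ (p - 2)) *
      (∫⁻ x in Ioo 0 (2 * π * y), g y (s + x)) ^ 2 + ENNReal.ofReal (y ^ (p - 2)) *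
      (∫⁻ x in Ioo 0 y, g x (s + 2 * π * y)) ^ 2) := by
        refine lintegral_mono fun s => lintegral_mono fun y => ?_
        refine (mul_le_mul_right (qaux_sq3 _ _ _) _).trans_eq ?_
        ring
    _ = 9 * ((∫⁻ s in Ioo a b, ∫⁻ y in Ioo 0 l, ENNReal.ofReal (y ^ (p - 2)) *
      (∫⁻ x in Ioo 0 y, g x s) ^ 2) + (∫⁻ s in Ioo a b, ∫⁻ y in Ioo 0 l,
      ENNReal.ofReal (y ^ (p - 2)) *
      (∫⁻ x in Ioo 0 (2 * π * y), g y (s + x)) ^ 2) + ∫⁻ s in Ioo a b, ∫⁻ y in Ioo 0 l,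
      ENNReal.ofReal (y ^ (p - 2)) *
      (∫⁻ x in Ioo 0 y, g x (s + 2 * π * y)) ^ 2) := by
        have m1 : Measurable (fun q : ℝ × ℝ => ENNReal.ofReal (q.2 ^ (p - 2)) *
          (∫⁻ x in Ioo 0 q.2, g x q.1) ^ 2) := mw.mul (mA.pow_const 2)
        have m2 : Measurable (fun q : ℝ × ℝ => ENNReal.ofReal (q.2 ^ (p - 2)) *
          (∫⁻ x in Ioo 0 (2 * π * q.2), g q.2 (q.1 + x)) ^ 2) := mw.mul (mB.pow_const 2)
        have s1 : ∀ s : ℝ, Measurable fun y : ℝ => (s, y) := fun s => by fun_prop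
        simp_rw [lintegral_const_mul' (9 : ℝ≥0∞) _ (by norm_num)]
        congr 1
        rw [← lintegral_add_left m1.lintegral_prod_right', ← lintegral_add_left]
        · refine lintegral_congr fun s => ?_
          rw [lintegral_add_left, lintegral_add_left]
          · exact m1.comp (s1 s)
          · exact (m1.comp (s1 s)).add (m2.comp (s1 s))
        · exact m1.lintegral_prod_right'.add m2.lintegral_prod_right'
    _ ≤ 9 * (qK p * V + ENNReal.ofReal ((2 * π) ^ 2) * V + qK p * V) := by gcongr
    _ = _ := by ring

lemma qaux_gradSq (F : ℂ → ℂ) (z : ℂ) :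
    gradSq F z = ‖fderiv ℝ F z 1‖ ^ 2 + ‖fderiv ℝ F z Complex.I‖ ^ 2 := by
  unfold gradSq wderiv wderivBar
  generalize fderiv ℝ F z 1 = a
  generalize fderiv ℝ F z Complex.I = b
  simp only [norm_div, div_pow, ← Complex.normSq_eq_norm_sq, Complex.normSq_apply]
  simp
  ring

lemma qaux_grad_nonneg (F : ℂ → ℂ) (z : ℂ) : 0 ≤ gradSq F z := by
  rw [qaux_gradSq]; positivity

lemma qaux_fderiv_le (F : ℂ → ℂ) (z w : ℂ) :
    ‖fderiv ℝ F z w‖ ≤ Real.sqrt (gradSq F z) * ‖w‖ := by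
  have hw : w = w.re • (1 : ℂ) + w.im • Complex.I := by
    simp [Complex.re_add_im]
  have h1 : ‖fderiv ℝ F z w‖ ≤ |w.re| * ‖fderiv ℝ F z 1‖ + |w.im| * ‖fderiv ℝ F z Complex.I‖ := by
    conv_lhs => rw [hw]
    rw [map_add, map_smul, map_smul]
    refine (norm_add_le _ _).trans ?_
    rw [norm_smul, norm_smul, Real.norm_eq_abs, Real.norm_eq_abs]
  refine h1.trans ?_
  rw [qaux_gradSq, ← Real.sqrt_sq (norm_nonneg w), ← Real.sqrt_mul (by positivity)]
  apply Real.le_sqrt_of_sq_le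
  rw [Complex.sq_norm w, Complex.normSq_apply w]
  have e1 := sq_abs w.re
  have e2 := sq_abs w.im
  generalize |w.re| = x at *
  generalize |w.im| = y at *
  rw [← sq w.re, ← sq w.im, ← e1, ← e2]
  nlinarith [sq_nonneg (x * ‖fderiv ℝ F z Complex.I‖ - y * ‖fderiv ℝ F z 1‖)]

lemma qaux_grad_meas (F : ℂ → ℂ) : Measurable (gradSq F) := by
  have : gradSq F = fun z => ‖fderiv ℝ F z 1‖ ^ 2 + ‖fderiv ℝ F z Complex.I‖ ^ 2 :=
    funext (qaux_gradSq F)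
  rw [this]
  have h1 := measurable_fderiv_apply_const ℝ F 1
  have h2 := measurable_fderiv_apply_const ℝ F Complex.I
  fun_prop

/-- gradient length as an extended nonnegative real -/
def qG (F : ℂ → ℂ) (z : ℂ) : ℝ≥0∞ := ENNReal.ofReal (Real.sqrt (gradSq F z))

lemma qG_sq (F : ℂ → ℂ) (z : ℂ) : qG F z ^ 2 = ENNReal.ofReal (gradSq F z) := by
  rw [qG, ← ENNReal.ofReal_pow (Real.sqrt_nonneg _), Real.sq_sqrt (qaux_grad_nonneg F z)]

lemma qG_meas (F : ℂ → ℂ) : Measurable (qG F) := by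
  have := qaux_grad_meas F
  unfold qG
  fun_prop

lemma qaux_curve {F : ℂ → ℂ} (hF : ContDiffOn ℝ 1 F unitDisk) {γ γ' : ℝ → ℂ} {a b : ℝ}
    (hab : a ≤ b) (hγ : ContDiff ℝ 1 γ) (hd : ∀ x, HasDerivAt γ (γ' x) x)
    (hm : ∀ x ∈ Icc a b, γ x ∈ unitDisk) (hn : ∀ x ∈ Icc a b, ‖γ' x‖ ≤ 1) :
    ‖F (γ b) - F (γ a)‖ₑ ≤ ∫⁻ x in Ioo a b, qG F (γ x) := by
  have hc : ContDiffOn ℝ 1 (F ∘ γ) (Icc a b) := hF.comp hγ.contDiffOn hm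
  refine (enorm_sub_le_lintegral_deriv_of_contDiffOn_Icc hc hab).trans ?_
  rw [← restrict_Ioo_eq_restrict_Icc]
  refine setLIntegral_mono' measurableSet_Ioo fun x hx => ?_
  have hx' := Ioo_subset_Icc_self hx
  have hFd : DifferentiableAt ℝ F (γ x) :=
    (hF.differentiableOn one_ne_zero).differentiableAt (isOpen_ball.mem_nhds (hm x hx'))
  have : HasDerivAt (F ∘ γ) (fderiv ℝ F (γ x) (γ' x)) x :=
    hFd.hasFDerivAt.comp_hasDerivAt x (hd x)
  rw [this.deriv, qG, ← ofReal_norm]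
  apply ENNReal.ofReal_le_ofReal
  refine (qaux_fderiv_le F _ _).trans ?_
  exact mul_le_of_le_one_right (Real.sqrt_nonneg _) (hn x hx')

def qpt (y v : ℝ) : ℂ := ((1 - y : ℝ) : ℂ) * Complex.exp (Complex.I * v)

lemma qpt_norm (y v : ℝ) : ‖qpt y v‖ = |1 - y| := by
  rw [qpt, norm_mul, Complex.norm_exp_I_mul_ofReal, mul_one, Complex.norm_real, Real.norm_eq_abs]

lemma qpt_mem {y v : ℝ} (h0 : 0 < y) (h1 : y < 1) : qpt y v ∈ unitDisk := by
  rw [unitDisk, mem_ball_zero_iff, qpt_norm, abs_of_pos (by linarith)]; linarith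

lemma qpt_meas : Measurable (fun q : ℝ × ℝ => qpt q.1 q.2) := by
  unfold qpt; fun_prop

lemma qaux_radial {F : ℂ → ℂ} (hF : ContDiffOn ℝ 1 F unitDisk) {s : ℝ} {c : ℂ}
    (hs : Tendsto (fun r : ℝ => F ((r : ℂ) * Complex.exp (Complex.I * s)))
      (nhdsWithin 1 (Set.Iio 1)) (nhds c)) {y : ℝ} (h0 : 0 < y) (h1 : y < 1) :
    ‖F (qpt y s) - c‖ₑ ≤ ∫⁻ x in Ioo 0 y, qG F (qpt x s) := by
  have ht : Tendsto (fun e : ℝ => F (qpt e s)) (nhdsWithin 0 (Ioi 0)) (nhds c) := by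
    have : Tendsto (fun e : ℝ => 1 - e) (nhdsWithin 0 (Ioi 0)) (nhdsWithin 1 (Iio 1)) := by
      apply tendsto_nhdsWithin_of_tendsto_nhds_of_eventually_within
      · apply tendsto_nhdsWithin_of_tendsto_nhds
        have : Continuous fun e : ℝ => 1 - e := by fun_prop
        simpa using this.tendsto 0
      · filter_upwards [self_mem_nhdsWithin] with e he
        have : 0 < e := he
        simpa using this
    exact hs.comp this
  have ht2 := (tendsto_const_nhds (x := F (qpt y s))).sub ht |>.enorm
  refine le_of_tendsto ht2 ?_
  filter_upwards [Ioo_mem_nhdsGT h0] with e he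
  have hd : ∀ x : ℝ, HasDerivAt (fun x => qpt x s) (-Complex.exp (Complex.I * s)) x := by
    intro x
    have : HasDerivAt (fun x : ℝ => ((1 - x : ℝ) : ℂ)) (-1) x := by
      simpa using ((hasDerivAt_id x).const_sub 1).ofReal_comp
    simpa [qpt] using this.mul_const (Complex.exp (Complex.I * s))
  have := qaux_curve hF (γ := fun x => qpt x s) he.2.le
    ((Complex.ofRealCLM.contDiff.comp
      (by fun_prop : ContDiff ℝ 1 fun x : ℝ => 1 - x)).mul contDiff_const) hd
    (fun x hx => qpt_mem (he.1.trans_le hx.1) (hx.2.trans_lt h1))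
    (fun x hx => by rw [norm_neg, Complex.norm_exp_I_mul_ofReal])
  exact this.trans (lintegral_mono_set (Ioo_subset_Ioo he.1.le le_rfl))

lemma qaux_angular {F : ℂ → ℂ} (hF : ContDiffOn ℝ 1 F unitDisk) (s : ℝ) {y t : ℝ}
    (h0 : 0 < y) (h1 : y < 1) (ht : 0 ≤ t) :
    ‖F (qpt y (s + t)) - F (qpt y s)‖ₑ ≤ ∫⁻ x in Ioo 0 t, qG F (qpt y (s + x)) := by
  have hd : ∀ x : ℝ, HasDerivAt (fun x => qpt y (s + x))
      (((1 - y : ℝ) : ℂ) * (Complex.exp (Complex.I * ((s + x : ℝ) : ℂ)) * Complex.I)) x := by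
    intro x
    have h1 : HasDerivAt (fun x : ℝ => ((s + x : ℝ) : ℂ)) 1 x := by
      simpa using ((hasDerivAt_id x).const_add s).ofReal_comp
    have h2 := (h1.const_mul Complex.I).cexp
    simpa [qpt] using h2.const_mul ((1 - y : ℝ) : ℂ)
  have := qaux_curve hF (γ := fun x => qpt y (s + x)) ht
    (contDiff_const.mul (contDiff_const.mul (Complex.ofRealCLM.contDiff.comp
      (by fun_prop : ContDiff ℝ 1 fun x : ℝ => s + x))).cexp) hd
    (fun x hx => qpt_mem h0 h1)
    (fun x hx => by
      rw [norm_mul, norm_mul, Complex.norm_exp_I_mul_ofReal, Complex.norm_real, Complex.norm_I,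
        Real.norm_eq_abs, abs_of_pos (by linarith)]
      linarith)
  simpa using this

def qk (p : ℝ) (f : ℝ → ℂ) (s u : ℝ) : ℝ≥0∞ :=
    ENNReal.ofReal (‖f s - f u‖ ^ 2 /
      ‖Complex.exp (Complex.I * s) - Complex.exp (Complex.I * u)‖ ^ (2 - p))

lemma qk_symm (p : ℝ) (f : ℝ → ℂ) (s u : ℝ) : qk p f s u = qk p f u s := by
  rw [qk, qk, norm_sub_rev, norm_sub_rev (Complex.exp _)]

lemma qk_meas (p : ℝ) {f : ℝ → ℂ} (hf : Measurable f) :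
    Measurable (fun q : ℝ × ℝ => qk p f q.1 q.2) := by
  unfold qk; fun_prop

lemma qaux_chord {s y : ℝ} (h0 : 0 < y) (h1 : y ≤ 1 / 2) :
    y ≤ ‖Complex.exp (Complex.I * s) - Complex.exp (Complex.I * ((s + 2 * π * y : ℝ) : ℂ))‖ := by
  have e : Complex.exp (Complex.I * s) - Complex.exp (Complex.I * ((s + 2 * π * y : ℝ) : ℂ)) =
      Complex.exp (Complex.I * s) * -(Complex.exp (Complex.I * ((2 * π * y : ℝ) : ℂ)) - 1) := by
    rw [ofReal_add, mul_add, Complex.exp_add]; ring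
  rw [e, norm_mul, Complex.norm_exp_I_mul_ofReal, norm_neg, one_mul,
    Complex.norm_exp_I_mul_ofReal_sub_one, show 2 * π * y / 2 = π * y by ring]
  have := Real.mul_le_sin (x := π * y) (by positivity) (by nlinarith [Real.pi_pos])
  rw [show 2 / π * (π * y) = 2 * y by field_simp] at this
  refine le_trans ?_ (Real.le_norm_self _)
  linarith

lemma qaux_point {p : ℝ} (hp1 : p < 1) {f : ℝ → ℂ} {F : ℂ → ℂ} (hF : ContDiffOn ℝ 1 F unitDisk)
    {s y : ℝ} (h0 : 0 < y) (h1 : y ≤ 1 / 2)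
    (hs : Tendsto (fun r : ℝ => F ((r : ℂ) * Complex.exp (Complex.I * s)))
      (nhdsWithin 1 (Set.Iio 1)) (nhds (f s)))
    (hs' : Tendsto (fun r : ℝ => F ((r : ℂ) * Complex.exp (Complex.I * ((s + 2 * π * y : ℝ) : ℂ))))
      (nhdsWithin 1 (Set.Iio 1)) (nhds (f (s + 2 * π * y)))) :
    qk p f s (s + 2 * π * y) ≤ ENNReal.ofReal (y ^ (p - 2)) *
      ((∫⁻ x in Ioo 0 y, qG F (qpt x s)) + (∫⁻ x in Ioo 0 (2 * π * y), qG F (qpt y (s + x))) +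
        ∫⁻ x in Ioo 0 y, qG F (qpt x (s + 2 * π * y))) ^ 2 := by
  have a1 := qaux_radial hF hs h0 (by linarith)
  have a2 := qaux_angular hF s h0 (by linarith) (t := 2 * π * y) (by positivity)
  have a3 := qaux_radial hF hs' h0 (by linarith)
  have tri : ‖f s - f (s + 2 * π * y)‖ₑ ≤ (∫⁻ x in Ioo 0 y, qG F (qpt x s)) +
      (∫⁻ x in Ioo 0 (2 * π * y), qG F (qpt y (s + x))) +
        ∫⁻ x in Ioo 0 y, qG F (qpt x (s + 2 * π * y)) := by
    calc ‖f s - f (s + 2 * π * y)‖ₑ = ‖-(F (qpt y s) - f s) -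
        (F (qpt y (s + 2 * π * y)) - F (qpt y s)) +
        (F (qpt y (s + 2 * π * y)) - f (s + 2 * π * y))‖ₑ := by congr 1; ring
      _ ≤ _ := enorm_add_le _ _
      _ ≤ _ := add_le_add_left (enorm_sub_le) _
      _ ≤ _ := by
        rw [enorm_neg]
        exact add_le_add (add_le_add a1 a2) a3
  have hch := qaux_chord (s := s) h0 h1
  calc qk p f s (s + 2 * π * y) ≤
      ENNReal.ofReal (y ^ (p - 2) * ‖f s - f (s + 2 * π * y)‖ ^ 2) := by
        apply ENNReal.ofReal_le_ofReal
        rw [div_eq_mul_inv, mul_comm, ← Real.rpow_neg (norm_nonneg _), neg_sub]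
        gcongr ?_ * _
        exact Real.rpow_le_rpow_of_nonpos h0 hch (by linarith)
    _ = ENNReal.ofReal (y ^ (p - 2)) * ‖f s - f (s + 2 * π * y)‖ₑ ^ 2 := by
        rw [ENNReal.ofReal_mul (by positivity), ENNReal.ofReal_pow (norm_nonneg _),
          ofReal_norm]
    _ ≤ _ := by gcongr

lemma qaux_cov (Φ : ℝ → ℝ≥0∞) (s l : ℝ) :
    ∫⁻ u in Ioo s (s + 2 * π * l), Φ u ≤
      ENNReal.ofReal (2 * π) * ∫⁻ y in Ioo 0 l, Φ (s + 2 * π * y) := by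
  have himg : Ioo s (s + 2 * π * l) ⊆ (fun y => s + 2 * π * y) '' Ioo 0 l := by
    intro u hu
    have hpi : 0 < 2 * π := by positivity
    refine ⟨(u - s) / (2 * π), ⟨div_pos (by linarith [hu.1]) hpi, ?_⟩, by field_simp; ring⟩
    rw [div_lt_iff₀ hpi]; linarith [hu.2]
  refine (lintegral_mono_set himg).trans_eq ?_
  rw [lintegral_image_eq_lintegral_abs_deriv_mul measurableSet_Ioo (f' := fun _ => 2 * π)]
  · simp only [abs_of_pos (show 0 < 2 * π by positivity)]
    rw [lintegral_const_mul' _ _ ENNReal.ofReal_ne_top]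
  · intro x _
    have := ((hasDerivAt_id x).const_mul (2 * π)).const_add s
    simpa using this.hasDerivWithinAt
  · intro x _ y _ h
    have hpi : 2 * π ≠ 0 := by positivity
    simpa [hpi] using h

lemma qaux_half {p : ℝ} (hp1 : p < 1) {f : ℝ → ℂ} {F : ℂ → ℂ} (hF : ContDiffOn ℝ 1 F unitDisk)
    (hlim : RadialLimit F f) (a b : ℝ) {l : ℝ} (hl : 0 < l) (hl2 : l ≤ 1 / 2) :
    ∫⁻ s in Ioo a b, ∫⁻ u in Ioo s (s + 2 * π * l), qk p f s u ≤
      ENNReal.ofReal (2 * π) * (9 * (2 * qK p + ENNReal.ofReal ((2 * π) ^ 2)) *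
      ∫⁻ v in Ioo a (b + 2 * π * l), ∫⁻ y in Ioo 0 l,
        ENNReal.ofReal (y ^ p) * ENNReal.ofReal (gradSq F (qpt y v))) := by
  have hg : Measurable (Function.uncurry fun y v => qG F (qpt y v)) := (qG_meas F).comp qpt_meas
  have core := qaux_core hp1 hg a b l hl
  simp only [qG_sq] at core
  refine le_trans ?_ (mul_le_mul_right core _)
  rw [← lintegral_const_mul' _ _ ENNReal.ofReal_ne_top]
  apply lintegral_mono_ae
  filter_upwards [ae_restrict_of_ae hlim] with s hs
  refine (qaux_cov _ _ _).trans (mul_le_mul_right ?_ _)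
  apply lintegral_mono_ae
  have hs' : ∀ᵐ y : ℝ, Tendsto (fun r : ℝ => F ((r : ℂ) *
      Complex.exp (Complex.I * ((s + 2 * π * y : ℝ) : ℂ))))
      (nhdsWithin 1 (Set.Iio 1)) (nhds (f (s + 2 * π * y))) := by
    have h1 := (measurePreserving_add_left volume s).quasiMeasurePreserving.ae hlim
    rw [ae_iff] at h1 ⊢
    have h2 := Real.volume_preimage_mul_left (a := 2 * π) (by positivity)
      {t | ¬ Tendsto (fun r : ℝ => F ((r : ℂ) * Complex.exp (Complex.I * ((s + t : ℝ) : ℂ))))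
      (nhdsWithin 1 (Set.Iio 1)) (nhds (f (s + t)))}
    rw [h1, mul_zero] at h2
    exact h2
  filter_upwards [ae_restrict_of_ae hs', self_mem_ae_restrict measurableSet_Ioo] with y hy hy2
  exact qaux_point hp1 hF hy2.1 (hy2.2.le.trans hl2) hs hy

lemma qaux_polar (p : ℝ) (hp0 : 0 < p) (F : ℂ → ℂ) (θ : ℝ) {H l : ℝ} (hH1 : H ≤ 1)
    (hlH : l ≤ H) (hl2 : l ≤ 1 / 2) :
    ∫⁻ v in Ioo (θ - π * H) (θ + π * H), ∫⁻ y in Ioo 0 l,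
        ENNReal.ofReal (y ^ p) * ENNReal.ofReal (gradSq F (qpt y v)) ≤
      2 * diskMeasure (fun z => gradSq F z * (1 - ‖z‖ ^ 2) ^ p) (carlesonBox θ H) := by
  have hgm := qaux_grad_meas F
  set W : ℂ → ℝ≥0∞ := fun z => ENNReal.ofReal (gradSq F z * (1 - ‖z‖ ^ 2) ^ p) with hW
  have hWm : Measurable W := by fun_prop
  set E : Set ℂ := {z | 1 - l < ‖z‖ ∧ ‖z‖ < 1 ∧
    |Complex.arg (Complex.exp (-(θ * Complex.I)) * z)| < π * H} with hE
  have hEm : MeasurableSet E := by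
    have e1 : MeasurableSet {z : ℂ | 1 - l < ‖z‖} := measurableSet_lt (by fun_prop) (by fun_prop)
    have e2 : MeasurableSet {z : ℂ | ‖z‖ < 1} := measurableSet_lt (by fun_prop) (by fun_prop)
    have e3 : MeasurableSet {z : ℂ |
        |Complex.arg (Complex.exp (-(θ * Complex.I)) * z)| < π * H} :=
      measurableSet_lt (by
        have : Measurable fun z : ℂ => Complex.arg (Complex.exp (-(θ * Complex.I)) * z) :=
          Complex.measurable_arg.comp (by fun_prop)
        exact this.abs) (by fun_prop)
    exact e1.inter (e2.inter e3)
  have hEbox : E ⊆ carlesonBox θ H := by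
    intro z hz
    refine ⟨by linarith [hz.1], hz.2.1, Complex.arg (Complex.exp (-(θ * Complex.I)) * z) + θ, ?_, ?_⟩
    · simpa using hz.2.2
    · have h1 := Complex.norm_mul_exp_arg_mul_I (Complex.exp (-(θ * Complex.I)) * z)
      have h2 : ‖Complex.exp (-(θ * Complex.I)) * z‖ = ‖z‖ := by
        rw [norm_mul, ← neg_mul, ← ofReal_neg, Complex.norm_exp_ofReal_mul_I, one_mul]
      rw [h2] at h1
      generalize Complex.arg (Complex.exp (-(θ * Complex.I)) * z) = α at *
      calc z = Complex.exp (θ * Complex.I) * (Complex.exp (-(θ * Complex.I)) * z) := by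
            rw [← mul_assoc, ← Complex.exp_add]; simp
        _ = Complex.exp (θ * Complex.I) * (‖z‖ * Complex.exp (α * Complex.I)) := by rw [h1]
        _ = ‖z‖ * (Complex.exp (α * Complex.I) * Complex.exp (θ * Complex.I)) := by ring
        _ = _ := by
            rw [← Complex.exp_add]; push_cast; congr 2; ring
  have hEd : E ⊆ unitDisk := by
    intro z hz
    rw [unitDisk, mem_ball_zero_iff]; exact hz.2.1
  have hmu : diskMeasure (fun z => gradSq F z * (1 - ‖z‖ ^ 2) ^ p) E = ∫⁻ z, E.indicator W z := by
    rw [diskMeasure, withDensity_apply _ hEm, Measure.restrict_restrict hEm,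
      inter_eq_left.2 hEd, lintegral_indicator hEm]
  have hrot : ∫⁻ z, E.indicator W z =
      ∫⁻ z, E.indicator W (Complex.exp (θ * Complex.I) * z) := by
    have := (LinearIsometryEquiv.measurePreserving (rotation (Circle.exp θ))).lintegral_comp
      (hWm.indicator hEm)
    rw [← this]
    simp [rotation_apply]
  set Ψ : ℝ × ℝ → ℝ≥0∞ := fun q => ENNReal.ofReal ((1 - q.1) ^ p) *
    ENNReal.ofReal (gradSq F (q.1 * Complex.exp (Complex.I * ((q.2 + θ : ℝ) : ℂ)))) with hΨ
  have hΨm : Measurable Ψ := by fun_prop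
  have hpolar : ∫⁻ q in Ioo (1 - l) 1 ×ˢ Ioo (-(π * H)) (π * H), Ψ q ≤
      2 * ∫⁻ z, E.indicator W (Complex.exp (θ * Complex.I) * z) := by
    rw [← Complex.lintegral_comp_polarCoord_symm, ← lintegral_const_mul' _ _ (by norm_num)]
    have hsub : Ioo (1 - l) 1 ×ˢ Ioo (-(π * H)) (π * H) ⊆ polarCoord.target := by
      intro q hq
      rw [polarCoord_target]
      have h1 := hq.1.1
      have h2 := hq.2
      have : π * H ≤ π := by nlinarith [Real.pi_pos]
      exact ⟨by simp; linarith, by linarith [h2.1], by linarith [h2.2]⟩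
    refine le_trans ?_ (lintegral_mono_set hsub)
    refine setLIntegral_mono' (measurableSet_Ioo.prod measurableSet_Ioo) fun q hq => ?_
    have h1 := hq.1.1
    have h1' := hq.1.2
    have h2 := hq.2.1
    have h2' := hq.2.2
    have hq0 : 0 < q.1 := by linarith
    have hpi : π * H ≤ π := by nlinarith [Real.pi_pos]
    rw [Complex.polarCoord_symm_apply]
    set z : ℂ := (q.1 : ℂ) * Complex.exp (Complex.I * ((q.2 + θ : ℝ) : ℂ)) with hz
    have hpol : Complex.exp (θ * Complex.I) *
        (q.1 * ((Real.cos q.2 : ℂ) + (Real.sin q.2 : ℂ) * Complex.I)) = z := by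
      rw [ofReal_cos, ofReal_sin, ← Complex.exp_mul_I, hz, ← mul_assoc,
        mul_comm (Complex.exp _) (q.1 : ℂ), mul_assoc, ← Complex.exp_add]
      congr 2
      push_cast; ring
    rw [hpol]
    have hzn : ‖z‖ = q.1 := by
      rw [hz, norm_mul, Complex.norm_exp_I_mul_ofReal, Complex.norm_real, Real.norm_eq_abs,
        abs_of_pos hq0, mul_one]
    have hzE : z ∈ E := by
      refine ⟨by rw [hzn]; exact h1, by rw [hzn]; exact h1', ?_⟩
      rw [← hpol, ← mul_assoc, ← Complex.exp_add, neg_add_cancel, Complex.exp_zero, one_mul,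
        ofReal_cos, ofReal_sin, Complex.arg_mul_cos_add_sin_mul_I hq0
          ⟨by linarith, by linarith⟩]
      exact abs_lt.2 ⟨h2, h2'⟩
    rw [indicator_of_mem hzE, hΨ, hW, smul_eq_mul]
    simp only
    rw [← hz, hzn, show (2 : ℝ≥0∞) = ENNReal.ofReal 2 by simp,
      ← ENNReal.ofReal_mul (Real.rpow_nonneg (by linarith) _), ← ENNReal.ofReal_mul hq0.le,
      ← ENNReal.ofReal_mul (by norm_num)]
    apply ENNReal.ofReal_le_ofReal
    have hg0 := qaux_grad_nonneg F z
    have hpow : (1 - q.1) ^ p ≤ (1 - q.1 ^ 2) ^ p :=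
      Real.rpow_le_rpow (by linarith) (by nlinarith) hp0.le
    have hpow0 : 0 ≤ (1 - q.1 ^ 2) ^ p := Real.rpow_nonneg (by nlinarith) _
    calc (1 - q.1) ^ p * gradSq F z ≤ 1 * ((1 - q.1 ^ 2) ^ p * gradSq F z) := by
          rw [one_mul]; gcongr
      _ ≤ (2 * q.1) * ((1 - q.1 ^ 2) ^ p * gradSq F z) := by
          gcongr; linarith
      _ = _ := by ring
  have hLHS : ∫⁻ v in Ioo (θ - π * H) (θ + π * H), ∫⁻ y in Ioo 0 l,
        ENNReal.ofReal (y ^ p) * ENNReal.ofReal (gradSq F (qpt y v)) =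
      ∫⁻ q in Ioo (1 - l) 1 ×ˢ Ioo (-(π * H)) (π * H), Ψ q := by
    rw [Measure.volume_eq_prod, setLIntegral_prod_symm _ hΨm.aemeasurable,
      ← lintegral_indicator measurableSet_Ioo, ← lintegral_indicator measurableSet_Ioo,
      ← lintegral_add_right_eq_self _ θ]
    refine lintegral_congr fun v => ?_
    have hiff : v + θ ∈ Ioo (θ - π * H) (θ + π * H) ↔ v ∈ Ioo (-(π * H)) (π * H) := by
      simp only [mem_Ioo]
      constructor <;> rintro ⟨_, _⟩ <;> constructor <;> linarith
    by_cases hv : v ∈ Ioo (-(π * H)) (π * H)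
    · rw [indicator_of_mem hv, indicator_of_mem (hiff.2 hv), ← lintegral_indicator measurableSet_Ioo,
        ← lintegral_indicator measurableSet_Ioo, ← lintegral_sub_left_eq_self _ (1 : ℝ)]
      refine lintegral_congr fun r => ?_
      have hiff' : 1 - r ∈ Ioo 0 l ↔ r ∈ Ioo (1 - l) 1 := by
        simp only [mem_Ioo]
        constructor <;> rintro ⟨_, _⟩ <;> constructor <;> linarith
      by_cases hr : r ∈ Ioo (1 - l) 1
      · rw [indicator_of_mem hr, indicator_of_mem (hiff'.2 hr), hΨ]
        simp [qpt]
      · rw [indicator_of_notMem hr, indicator_of_notMem (fun h => hr (hiff'.1 h))]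
    · rw [indicator_of_notMem hv, indicator_of_notMem (fun h => hv (hiff.1 h))]
  rw [hLHS]
  refine hpolar.trans ?_
  rw [← hrot, ← hmu]
  gcongr

lemma qaux_swap {k : ℝ → ℝ → ℝ≥0∞} (hk : Measurable (Function.uncurry k)) (a b L : ℝ) :
    ∫⁻ s in Ioo a b, ∫⁻ u in Ioo (s - L) s, k s u ≤
      ∫⁻ u in Ioo (a - L) b, ∫⁻ s in Ioo u (u + L), k s u := by
  have hm : MeasurableSet {q : ℝ × ℝ | q.1 - L < q.2 ∧ q.2 < q.1 ∧ a < q.1 ∧ q.1 < b} := by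
    have e1 : MeasurableSet {q : ℝ × ℝ | q.1 - L < q.2} := measurableSet_lt (by fun_prop) (by fun_prop)
    have e2 : MeasurableSet {q : ℝ × ℝ | q.2 < q.1} := measurableSet_lt (by fun_prop) (by fun_prop)
    have e3 : MeasurableSet {q : ℝ × ℝ | a < q.1} := measurableSet_lt (by fun_prop) (by fun_prop)
    have e4 : MeasurableSet {q : ℝ × ℝ | q.1 < b} := measurableSet_lt (by fun_prop) (by fun_prop)
    exact e1.inter (e2.inter (e3.inter e4))
  set J : ℝ → ℝ → ℝ≥0∞ := fun s u =>
    {q : ℝ × ℝ | q.1 - L < q.2 ∧ q.2 < q.1 ∧ a < q.1 ∧ q.1 < b}.indicator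
      (Function.uncurry k) (s, u) with hJ
  have hJm : Measurable (Function.uncurry J) := hk.indicator hm
  calc _ ≤ ∫⁻ s, ∫⁻ u, J s u := by
        rw [← lintegral_indicator measurableSet_Ioo]
        refine lintegral_mono fun s => ?_
        by_cases hs : s ∈ Ioo a b
        · rw [indicator_of_mem hs, ← lintegral_indicator measurableSet_Ioo]
          refine lintegral_mono fun u => ?_
          by_cases hu : u ∈ Ioo (s - L) s
          · rw [indicator_of_mem hu]
            simp [hJ, indicator, hu.1, hu.2, hs.1, hs.2]
          · simp [indicator_of_notMem hu]
        · simp [indicator_of_notMem hs]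
    _ = ∫⁻ u, ∫⁻ s, J s u := lintegral_lintegral_swap hJm.aemeasurable
    _ ≤ _ := by
        rw [← lintegral_indicator measurableSet_Ioo]
        refine lintegral_mono fun u => ?_
        by_cases hu : u ∈ Ioo (a - L) b
        · rw [indicator_of_mem hu, ← lintegral_indicator measurableSet_Ioo]
          refine lintegral_mono fun s => ?_
          by_cases hq : s - L < u ∧ u < s ∧ a < s ∧ s < b
          · rw [indicator_of_mem (show s ∈ Ioo u (u + L) from ⟨hq.2.1, by linarith [hq.1]⟩)]
            exact (indicator_of_mem (show (s, u) ∈ {q : ℝ × ℝ | q.1 - L < q.2 ∧ q.2 < q.1 ∧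
              a < q.1 ∧ q.1 < b} from hq) _).le
          · refine le_of_eq_of_le (indicator_of_notMem (show (s, u) ∉ {q : ℝ × ℝ |
              q.1 - L < q.2 ∧ q.2 < q.1 ∧ a < q.1 ∧ q.1 < b} from hq) _) zero_le
        · refine le_of_eq_of_le ?_ zero_le
          rw [← lintegral_zero (μ := (volume : Measure ℝ))]
          refine lintegral_congr fun s => ?_
          have hn : (s, u) ∉ {q : ℝ × ℝ | q.1 - L < q.2 ∧ q.2 < q.1 ∧ a < q.1 ∧ q.1 < b} := by
            intro (hq : s - L < u ∧ u < s ∧ a < s ∧ s < b)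
            exact hu ⟨by linarith [hq.1, hq.2.2.1], by linarith [hq.2.1, hq.2.2.2]⟩
          exact indicator_of_notMem hn _

lemma qaux_measC {k : ℝ → ℝ → ℝ≥0∞} (hk : Measurable (Function.uncurry k)) (L : ℝ) :
    Measurable (fun s => ∫⁻ u in Ioo s (s + L), k s u) := by
  have hm : MeasurableSet {q : ℝ × ℝ | q.1 < q.2 ∧ q.2 < q.1 + L} := by
    have e1 : MeasurableSet {q : ℝ × ℝ | q.1 < q.2} := measurableSet_lt (by fun_prop) (by fun_prop)
    have e2 : MeasurableSet {q : ℝ × ℝ | q.2 < q.1 + L} :=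
      measurableSet_lt (by fun_prop) (by fun_prop)
    exact e1.inter e2
  have h := (hk.indicator hm).lintegral_prod_right' (ν := (volume : Measure ℝ))
  convert h using 2 with s
  rw [← lintegral_indicator measurableSet_Ioo]
  rfl

lemma qaux_sym (p : ℝ) {f : ℝ → ℂ} (hf : Measurable f) (a b : ℝ) {L : ℝ} (hL : 0 < L) :
    ∫⁻ s in Ioo a b, ∫⁻ u in Ioo (s - L) (s + L), qk p f s u ≤
      2 * ∫⁻ s in Ioo (a - L) b, ∫⁻ u in Ioo s (s + L), qk p f s u := by
  have hk : Measurable (Function.uncurry (qk p f)) := qk_meas p hf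
  calc _ ≤ ∫⁻ s in Ioo a b, ((∫⁻ u in Ioo s (s + L), qk p f s u) +
        ∫⁻ u in Ioo (s - L) s, qk p f s u) := by
        refine lintegral_mono fun s => ?_
        rw [restrict_Ioo_eq_restrict_Ioc (a := s - L) (b := s)]
        refine le_trans (lintegral_mono_set ?_) (lintegral_union_le _ _ _)
        intro u hu
        rcases le_or_gt u s with h | h
        · exact Or.inr ⟨hu.1, h⟩
        · exact Or.inl ⟨h, hu.2⟩
    _ = (∫⁻ s in Ioo a b, ∫⁻ u in Ioo s (s + L), qk p f s u) +
        ∫⁻ s in Ioo a b, ∫⁻ u in Ioo (s - L) s, qk p f s u :=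
        lintegral_add_left (qaux_measC hk L) _
    _ ≤ (∫⁻ s in Ioo (a - L) b, ∫⁻ u in Ioo s (s + L), qk p f s u) +
        ∫⁻ s in Ioo (a - L) b, ∫⁻ u in Ioo s (s + L), qk p f s u := by
        refine add_le_add (lintegral_mono_set (Ioo_subset_Ioo_left (by linarith))) ?_
        refine (qaux_swap hk a b L).trans (le_of_eq ?_)
        refine lintegral_congr fun u => lintegral_congr fun s => qk_symm p f s u
    _ = _ := by rw [two_mul]

lemma qk_per (p : ℝ) {f : ℝ → ℂ} (hper : Function.Periodic f (2 * π)) (s : ℝ) :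
    Function.Periodic (qk p f s) (2 * π) := by
  intro u
  have e : Complex.exp (Complex.I * ((u + 2 * π : ℝ) : ℂ)) = Complex.exp (Complex.I * u) := by
    rw [show Complex.I * ((u + 2 * π : ℝ) : ℂ) = Complex.I * u + 2 * π * Complex.I by
      push_cast; ring]
    exact Complex.exp_periodic _
  unfold qk
  rw [hper u, e]

lemma qaux_perint {g : ℝ → ℝ≥0∞} (hper : Function.Periodic g (2 * π)) (a b : ℝ) :
    ∫⁻ u in Ioc a (a + 2 * π), g u = ∫⁻ u in Ioc b (b + 2 * π), g u := by
  refine (isAddFundamentalDomain_Ioc Real.two_pi_pos a).setLIntegral_eq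
    (isAddFundamentalDomain_Ioc Real.two_pi_pos b) g ?_
  exact hper.map_vadd_zmultiples

lemma qaux_main1 {p : ℝ} (hp1 : p < 1) {f : ℝ → ℂ} (hf : Measurable f) {F : ℂ → ℂ}
    (hF : ContDiffOn ℝ 1 F unitDisk) (hlim : RadialLimit F f) (θ h : ℝ) {l : ℝ} (hl : 0 < l)
    (hl2 : l ≤ 1 / 2)
    (hin : ∀ s ∈ Ioo (θ - π * h) (θ + π * h), ∫⁻ u in Ioo (θ - π * h) (θ + π * h), qk p f s u ≤
      ∫⁻ u in Ioo (s - 2 * π * l) (s + 2 * π * l), qk p f s u) :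
    qpTDouble p f θ h ≤ 2 * (ENNReal.ofReal (2 * π) *
      (9 * (2 * qK p + ENNReal.ofReal ((2 * π) ^ 2)) *
      ∫⁻ v in Ioo (θ - π * h - 2 * π * l) (θ + π * h + 2 * π * l), ∫⁻ y in Ioo 0 l,
        ENNReal.ofReal (y ^ p) * ENNReal.ofReal (gradSq F (qpt y v)))) := by
  calc qpTDouble p f θ h ≤ ∫⁻ s in Ioo (θ - π * h) (θ + π * h),
        ∫⁻ u in Ioo (s - 2 * π * l) (s + 2 * π * l), qk p f s u :=
        setLIntegral_mono' measurableSet_Ioo hin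
    _ ≤ _ := qaux_sym p hf _ _ (by have := Real.pi_pos; positivity)
    _ ≤ _ := by
        gcongr
        exact qaux_half hp1 hF hlim _ _ hl hl2

lemma qaux_bound {p : ℝ} (hp0 : 0 < p) (hp1 : p < 1) {f : ℝ → ℂ} (hf : Measurable f)
    (hper : Function.Periodic f (2 * π)) {F : ℂ → ℂ}
    (hF : ContDiffOn ℝ 1 F unitDisk) (hlim : RadialLimit F f) {C : ℝ}
    (hC : ∀ θ : ℝ, ∀ h ∈ Set.Ioc (0 : ℝ) 1,
      diskMeasure (fun z => gradSq F z * (1 - ‖z‖ ^ 2) ^ p) (carlesonBox θ h) ≤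
        ENNReal.ofReal (C * h ^ p)) (θ h : ℝ) (hh : h ∈ Ioc (0 : ℝ) 1) :
    qpTDouble p f θ h ≤ 2 * (ENNReal.ofReal (2 * π) *
      (9 * (2 * qK p + ENNReal.ofReal ((2 * π) ^ 2)) *
      (6 * ENNReal.ofReal (|C| * (3 * h) ^ p)))) := by
  have hpi := Real.pi_pos
  obtain ⟨hh0, hh1⟩ := hh
  rcases le_or_gt h (1 / 3) with h3 | h3
  · refine (qaux_main1 hp1 hf hF hlim θ h hh0 (by linarith) ?_).trans ?_
    · intro s hs
      refine lintegral_mono_set fun u hu => ⟨?_, ?_⟩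
      · linarith [hs.2, hu.1]
      · linarith [hs.1, hu.2]
    · gcongr
      have e := qaux_polar p hp0 F θ (H := 3 * h) (l := h) (by linarith) (by linarith) (by linarith)
      rw [show θ - π * h - 2 * π * h = θ - π * (3 * h) by ring,
        show θ + π * h + 2 * π * h = θ + π * (3 * h) by ring]
      refine e.trans ?_
      refine mul_le_mul' (by norm_num) ((hC θ (3 * h) ⟨by linarith, by linarith⟩).trans ?_)
      apply ENNReal.ofReal_le_ofReal
      gcongr
      exact le_abs_self C
  · refine (qaux_main1 hp1 hf hF hlim θ h (l := 1 / 2) (by norm_num) le_rfl ?_).trans ?_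
    · intro s hs
      rw [show s - 2 * π * (1 / 2) = s - π by ring, show s + 2 * π * (1 / 2) = s + π by ring,
        restrict_Ioo_eq_restrict_Ioc (a := s - π) (b := s + π)]
      have e := qaux_perint (qk_per p hper s) (s - π) (θ - π)
      rw [show s - π + 2 * π = s + π by ring, show θ - π + 2 * π = θ + π by ring] at e
      rw [e]
      refine lintegral_mono_set fun u hu => ⟨?_, ?_⟩
      · nlinarith [hu.1]
      · nlinarith [hu.2]
    · gcongr
      set Φ : ℝ → ℝ≥0∞ := fun v => ∫⁻ y in Ioo 0 (1 / 2 : ℝ),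
        ENNReal.ofReal (y ^ p) * ENNReal.ofReal (gradSq F (qpt y v)) with hΦ
      have key : ∀ t : ℝ, ∫⁻ v in Ioo (t - π) (t + π), Φ v ≤
          2 * ENNReal.ofReal (|C| * (3 * h) ^ p) := by
        intro t
        have e := qaux_polar p hp0 F t (H := 1) (l := 1 / 2) le_rfl (by norm_num) le_rfl
        rw [mul_one] at e
        refine e.trans (mul_le_mul' le_rfl ((hC t 1 ⟨by norm_num, le_rfl⟩).trans ?_))
        apply ENNReal.ofReal_le_ofReal
        rw [Real.one_rpow]
        have h1 : 1 ≤ (3 * h) ^ p := Real.one_le_rpow (by linarith) hp0.le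
        exact mul_le_mul (le_abs_self C) h1 zero_le_one (abs_nonneg C)
      calc _ ≤ ∫⁻ v in Ioo (θ - π - π) (θ - π + π) ∪
            (Ioo (θ - π) (θ + π) ∪ Ioo (θ + π - π) (θ + π + π)), Φ v := by
            refine lintegral_mono_set fun u hu => ?_
            have hu1 : θ - 2 * π < u := by nlinarith [hu.1]
            have hu2 : u < θ + 2 * π := by nlinarith [hu.2]
            rcases lt_trichotomy u θ with hlt | heq | hgt
            · exact Or.inl ⟨by linarith, by linarith⟩
            · exact Or.inr (Or.inl ⟨by linarith, by linarith⟩)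
            · exact Or.inr (Or.inr ⟨by linarith, by linarith⟩)
        _ ≤ _ := lintegral_union_le _ _ _
        _ ≤ _ := add_le_add le_rfl (lintegral_union_le _ _ _)
        _ ≤ 2 * ENNReal.ofReal (|C| * (3 * h) ^ p) + (2 * ENNReal.ofReal (|C| * (3 * h) ^ p) +
            2 * ENNReal.ofReal (|C| * (3 * h) ^ p)) :=
            add_le_add (key _) (add_le_add (key _) (key _))
        _ = _ := by ring

/-- For `0 < p < 1`: if `f ∈ L²(𝕋)`, `F` is `C¹` on the unit disk with radial limits
`f` a.e. on the circle, and `|∇F(z)|² (1-|z|²)^p dA(z)` is a `p`-Carleson measure,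
then `f ∈ Q_p(𝕋)`. -/
theorem memQpT_of_C1_extension (p : ℝ) (hp0 : 0 < p) (hp1 : p < 1)
    (f : ℝ → ℂ) (hfm : Measurable f) (hfper : Function.Periodic f (2 * Real.pi))
    (hfL2 : l2Circle f < ⊤)
    (F : ℂ → ℂ) (hF : ContDiffOn ℝ 1 F unitDisk)
    (hlim : RadialLimit F f)
    (hcar : IsPCarleson p (diskMeasure fun z => gradSq F z * (1 - ‖z‖ ^ 2) ^ p)) :
    MemQpT p f := by
  obtain ⟨C, hC⟩ := hcar
  refine ⟨hfper, hfm, hfL2, 2 * (2 * π * (9 * (2 * (4 / (1 - p) ^ 2) + (2 * π) ^ 2) *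
    (6 * (|C| * 3 ^ p)))), fun θ h hh => ?_⟩
  have hpi := Real.pi_pos
  have hh0 : 0 < h := hh.1
  refine (qaux_bound hp0 hp1 hfm hfper hF hlim hC θ h hh).trans (le_of_eq ?_)
  have e2 : (2 : ℝ≥0∞) = ENNReal.ofReal 2 := by simp
  have e9 : (9 : ℝ≥0∞) = ENNReal.ofReal 9 := by simp
  have e6 : (6 : ℝ≥0∞) = ENNReal.ofReal 6 := by simp
  have h3 : (0 : ℝ) ≤ (3 * h) ^ p := Real.rpow_nonneg (by linarith) _
  rw [qK, e2, e9, e6, ← ENNReal.ofReal_mul (by norm_num),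
    ← ENNReal.ofReal_add (by positivity) (by positivity), ← ENNReal.ofReal_mul (by positivity),
    ← ENNReal.ofReal_mul (by positivity), ← ENNReal.ofReal_mul (by positivity),
    ← ENNReal.ofReal_mul (by positivity), ← ENNReal.ofReal_mul (by positivity),
    Real.mul_rpow (by norm_num) hh0.le]
  congr 1
  ring

end
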